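/- For every integer t ≥ 10, N(31 · 2^t) ≥ 31. -/

import Mathlib

/-- A latin square of order `n`: an `n × n` array with entries from an `n`-element
symbol set such that every row and every column contains each symbol exactly once. -/
def IsLatinSquare {n : ℕ} (L : Fin n → Fin n → Fin n) : Prop :=
  (∀ i, Function.Bijective fun j => L i j) ∧ (∀ j, Function.Bijective fun i => L i j)

/-- Two latin squares of order `n` are orthogonal if the `n²` superimposed
ordered pairs of entries are all distinct. -/
def AreOrthogonal {n : ℕ} (L M : Fin n → Fin n → Fin n) : Prop :=
  Function.Injective fun p : Fin n × Fin n => (L p.1 p.2, M p.1 p.2)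

/-- There exist `r` mutually orthogonal latin squares (MOLS) of order `n`. -/
def HasMOLS (n r : ℕ) : Prop :=
  ∃ L : Fin r → Fin n → Fin n → Fin n,
    (∀ s, IsLatinSquare (L s)) ∧ ∀ s t : Fin r, s ≠ t → AreOrthogonal (L s) (L t)

/-- `molsNum n` is `N(n)`, the maximum size of a set of MOLS of order `n`. -/
noncomputable def molsNum (n : ℕ) : ℕ := sSup {r | HasMOLS n r}

/-- An orthogonal array with `33` columns and `n` symbols, on arbitrary block and symbol types. -/
def OAT (n : ℕ) : Prop :=
  ∃ f : Option (Fin 32) → (Fin n × Fin n) → Fin n,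
    ∀ i j, i ≠ j → Function.Injective fun b => (f i b, f j b)

/-- Transport an orthogonal array on arbitrary types to `Fin n`. -/
lemma OAT.of_types {n : ℕ} {B : Type} [Fintype B] {X : Option (Fin 32) → Type}
    [∀ i, Fintype (X i)] (hB : Fintype.card B = n * n) (hX : ∀ i, Fintype.card (X i) = n)
    (f : ∀ i, B → X i)
    (hf : ∀ i j, i ≠ j → ∀ b c, f i b = f i c → f j b = f j c → b = c) : OAT n := by
  have eB : B ≃ Fin n × Fin n := Fintype.equivOfCardEq (by simp [hB])
  have eX : ∀ i, X i ≃ Fin n := fun i => Fintype.equivOfCardEq (by simp [hX i])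
  refine ⟨fun i b => eX i (f i (eB.symm b)), ?_⟩
  intro i j hij b c h
  simp only [Prod.mk.injEq, EmbeddingLike.apply_eq_iff_eq] at h
  exact eB.symm.injective (hf i j hij _ _ h.1 h.2)

/-- MacNeish product. -/
lemma OAT.mul {m n : ℕ} (hm : OAT m) (hn : OAT n) : OAT (m * n) := by
  obtain ⟨f, hf⟩ := hm
  obtain ⟨g, hg⟩ := hn
  refine OAT.of_types (B := (Fin m × Fin m) × (Fin n × Fin n)) (X := fun _ => Fin m × Fin n)
    (by simp; ring) (by simp) (fun i b => (f i b.1, g i b.2)) ?_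
  intro i j hij b c h1 h2
  simp only [Prod.mk.injEq] at h1 h2
  exact Prod.ext (hf i j hij (Prod.ext h1.1 h2.1)) (hg i j hij (Prod.ext h1.2 h2.2))

/-- Two points determine a line. -/
lemma line_inj {F : Type} [Field F] {x y u v u' v' : F} (hxy : x ≠ y)
    (h1 : u * x + v = u' * x + v') (h2 : u * y + v = u' * y + v') : u = u' ∧ v = v' := by
  have h : (u - u') * (x - y) = 0 := by linear_combination h1 - h2
  have hu : u = u' := by
    rcases mul_eq_zero.1 h with h | h
    · exact sub_eq_zero.1 h
    · exact absurd (sub_eq_zero.1 h) hxy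
  subst hu
  exact ⟨rfl, by linear_combination h1⟩

/-- Orthogonal arrays from fields. -/
lemma OAT.of_field (F : Type) [Field F] [Fintype F] (h : 32 ≤ Fintype.card F) :
    OAT (Fintype.card F) := by
  obtain ⟨φ⟩ : Nonempty (Fin 32 ↪ F) := Function.Embedding.nonempty_of_card_le (by simpa using h)
  refine OAT.of_types (B := F × F) (X := fun _ => F) (by simp) (by simp)
    (fun i b => match i with
      | none => b.1
      | some x => b.1 * φ x + b.2) ?_
  rintro (_ | x) (_ | y) hij ⟨u, v⟩ ⟨u', v'⟩ h1 h2
  · exact absurd rfl hij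
  · simp only at h1 h2
    subst h1
    simpa using h2
  · simp only at h1 h2
    subst h2
    simpa using h1
  · have hxy : φ x ≠ φ y := fun h => hij (by rw [φ.injective h])
    obtain ⟨rfl, rfl⟩ := line_inj hxy h1 h2
    rfl

/-- The orthogonal array with `32` columns and `31` symbols. -/
lemma oa_31 : ∃ a : Fin 32 → (ZMod 31 × ZMod 31) → ZMod 31,
    ∀ x y, x ≠ y → ∀ b c, a x b = a x c → a y b = a y c → b = c := by
  haveI : Fact (Nat.Prime 31) := ⟨by norm_num⟩
  have e : Fin 32 ≃ Option (ZMod 31) := Fintype.equivOfCardEq (by simp [ZMod.card])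
  refine ⟨fun x b => match e x with
      | none => b.1
      | some x => b.1 * x + b.2, ?_⟩
  rintro x y hxy ⟨u, v⟩ ⟨u', v'⟩ h1 h2
  have hxy' : e x ≠ e y := fun h => hxy (e.injective h)
  revert hxy' h1 h2
  dsimp only
  generalize e x = p
  generalize e y = q
  intro h1 h2 hpq
  rcases p with _ | p <;> rcases q with _ | q
  · exact absurd rfl hpq
  · simp only at h1 h2
    subst h1
    simpa using h2
  · simp only at h1 h2
    subst h2
    simpa using h1
  · have hxy : p ≠ q := fun h => hpq (by rw [h])
    obtain ⟨rfl, rfl⟩ := line_inj hxy h1 h2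
    rfl

open Classical in
/-- The three factor product (Dukes–Ling) for `31 · 32 · q`. -/
lemma OAT.three (F E : Type) [Field F] [Fintype F] [Field E] [Fintype E]
    (hF : Fintype.card F = 32) (hE : 32 ≤ Fintype.card E) (hE' : Fintype.card E ≤ 992) :
    OAT (992 * Fintype.card E) := by
  obtain ⟨a, ha⟩ := oa_31
  obtain ⟨κ⟩ : Nonempty (Fin 32 ↪ F) := Function.Embedding.nonempty_of_card_le (by simp [hF])
  obtain ⟨φ⟩ : Nonempty (Fin 32 ↪ E) := Function.Embedding.nonempty_of_card_le (by simpa using hE)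
  -- the labels of the nonzero slopes
  obtain ⟨lam, hlam⟩ : ∃ lam : F → ZMod 31, ∀ u v, u ≠ 0 → v ≠ 0 → lam u = lam v → u = v := by
    have e : {u : F // u ≠ 0} ≃ ZMod 31 := Fintype.equivOfCardEq (by
      rw [Fintype.card_subtype_compl]; simp [hF, ZMod.card])
    refine ⟨fun u => if h : u ≠ 0 then e ⟨u, h⟩ else 0, fun u v hu hv h => ?_⟩
    simp only [hu, hv, ne_eq, not_false_eq_true, dite_true] at h
    simpa using e.injective h
  -- the parallel classes absorbed in the composite class
  obtain ⟨S, hS⟩ : ∃ S : Finset (ZMod 31 × ZMod 31), S.card = Fintype.card E - 31 := by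
    obtain ⟨S, -, hS⟩ := Finset.exists_subset_card_eq
      (s := (Finset.univ : Finset (ZMod 31 × ZMod 31))) (n := Fintype.card E - 31)
      (by rw [Finset.card_univ, Fintype.card_prod, ZMod.card]; omega)
    exact ⟨S, hS⟩
  have e : ZMod 31 ⊕ {T // T ∈ S} ≃ E := Fintype.equivOfCardEq (by
    rw [Fintype.card_sum, ZMod.card, Fintype.card_coe, hS]; omega)
  let lab : Fin 32 → F → (ZMod 31 × ZMod 31) → E := fun x u T =>
    if u = 0 then e (Sum.inl (a (x + 1) T))
    else if h : T ∈ S then e (Sum.inr ⟨T, h⟩) else 0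
  let P : Fin 32 → (F × F) × (ZMod 31 × ZMod 31) × (E × E) → F × ZMod 31 × E := fun x b =>
    (b.1.1 * κ x + b.1.2, lam b.1.1 + a x b.2.1,
      (b.2.2.1 * φ x + b.2.2.2) + lab x b.1.1 b.2.1)
  let Y : Type := (E × E) ⊕ ({T : ZMod 31 × ZMod 31 // T ∉ S} × E)
  let Q : (F × F) × (ZMod 31 × ZMod 31) × (E × E) → Y := fun b =>
    if b.1.1 = 0 then Sum.inl b.2.2
    else if h : b.2.1 ∈ S then Sum.inl b.2.2 else Sum.inr (⟨b.2.1, h⟩, b.2.2.1)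
  have hPP : ∀ x y, x ≠ y → ∀ b c, P x b = P x c → P y b = P y c → b = c := by
    rintro x y hxy ⟨⟨u, v⟩, T, ⟨s, t⟩⟩ ⟨⟨u', v'⟩, T', ⟨s', t'⟩⟩ h1 h2
    simp only [P, Prod.mk.injEq] at h1 h2
    obtain ⟨h1, h3, h5⟩ := h1
    obtain ⟨h2, h4, h6⟩ := h2
    obtain ⟨rfl, rfl⟩ := line_inj (fun h => hxy (κ.injective h)) h1 h2
    obtain rfl := ha x y hxy T T' (add_left_cancel h3) (add_left_cancel h4)
    obtain ⟨rfl, rfl⟩ := line_inj (fun h => hxy (φ.injective h))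
      (add_right_cancel h5) (add_right_cancel h6)
    rfl
  have hsucc : ∀ x : Fin 32, x ≠ x + 1 := by decide
  have hPQ : ∀ x b c, P x b = P x c → Q b = Q c → b = c := by
    rintro x ⟨⟨u, v⟩, T, ⟨s, t⟩⟩ ⟨⟨u', v'⟩, T', ⟨s', t'⟩⟩ h1 h2
    simp only [P, Prod.mk.injEq] at h1
    obtain ⟨h1, h3, h5⟩ := h1
    have hx : x ≠ x + 1 := hsucc x
    by_cases hu : u = 0 <;> by_cases hu' : u' = 0
    · subst hu hu'
      simp only [Q, if_true, Sum.inl.injEq, Prod.mk.injEq] at h2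
      obtain ⟨rfl, rfl⟩ := h2
      have h6 := add_left_cancel h5
      simp only [lab, if_true, EmbeddingLike.apply_eq_iff_eq, Sum.inl.injEq] at h6
      obtain rfl := ha x (x + 1) hx T T' (add_left_cancel h3) h6
      obtain rfl := add_left_cancel h1
      rfl
    · by_cases hT' : T' ∈ S
      · simp only [Q, hu, hu', hT', if_true, if_false, dite_true, Sum.inl.injEq,
          Prod.mk.injEq] at h2
        obtain ⟨rfl, rfl⟩ := h2
        have h6 := add_left_cancel h5
        simp [lab, hu, hu', hT'] at h6
      · simp [Q, hu, hu', hT'] at h2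
    · by_cases hT : T ∈ S
      · simp only [Q, hu, hu', hT, if_true, if_false, dite_true, Sum.inl.injEq,
          Prod.mk.injEq] at h2
        obtain ⟨rfl, rfl⟩ := h2
        have h6 := add_left_cancel h5
        simp [lab, hu, hu', hT] at h6
      · simp [Q, hu, hu', hT] at h2
    · by_cases hT : T ∈ S <;> by_cases hT' : T' ∈ S
      · simp only [Q, hu, hu', hT, hT', if_false, dite_true, Sum.inl.injEq,
          Prod.mk.injEq] at h2
        obtain ⟨rfl, rfl⟩ := h2
        have h6 := add_left_cancel h5
        simp only [lab, hu, hu', hT, hT', if_false, dite_true, EmbeddingLike.apply_eq_iff_eq,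
          Sum.inr.injEq, Subtype.mk.injEq] at h6
        subst h6
        obtain rfl := hlam u u' hu hu' (add_right_cancel h3)
        obtain rfl := add_left_cancel h1
        rfl
      · simp [Q, hu, hu', hT, hT'] at h2
      · simp [Q, hu, hu', hT, hT'] at h2
      · simp only [Q, hu, hu', hT, hT', if_false, dite_false, Sum.inr.injEq,
          Prod.mk.injEq, Subtype.mk.injEq] at h2
        obtain ⟨rfl, rfl⟩ := h2
        obtain rfl := hlam u u' hu hu' (add_right_cancel h3)
        obtain rfl := add_left_cancel h1
        have h6 : t = t' := by
          have := add_right_cancel (b := lab x u T) h5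
          exact add_left_cancel this
        subst h6
        rfl
  have hY : Fintype.card Y = 992 * Fintype.card E := by
    have h1 : Fintype.card {T : ZMod 31 × ZMod 31 // T ∉ S} = 992 - Fintype.card E := by
      rw [Fintype.card_subtype_compl, Fintype.card_coe, hS, Fintype.card_prod, ZMod.card]
      omega
    change Fintype.card ((E × E) ⊕ ({T : ZMod 31 × ZMod 31 // T ∉ S} × E)) = _
    rw [Fintype.card_sum, Fintype.card_prod, Fintype.card_prod, h1, ← add_mul]
    congr 1
    omega
  let X : Option (Fin 32) → Type := fun i => match i with
    | none => Y
    | some _ => F × ZMod 31 × E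
  letI : ∀ i, Fintype (X i) := fun i => match i with
    | none => inferInstanceAs (Fintype ((E × E) ⊕ ({T : ZMod 31 × ZMod 31 // T ∉ S} × E)))
    | some _ => inferInstanceAs (Fintype (F × ZMod 31 × E))
  refine OAT.of_types (B := (F × F) × (ZMod 31 × ZMod 31) × (E × E)) (X := X) ?_ ?_
    (fun i => match i with
      | none => Q
      | some x => P x) ?_
  · simp only [Fintype.card_prod, hF, ZMod.card]
    ring
  · rintro (_ | x)
    · exact hY
    · change Fintype.card (F × ZMod 31 × E) = _
      simp only [Fintype.card_prod, hF, ZMod.card]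
      ring
  · rintro (_ | x) (_ | y) hij b c h1 h2
    · exact absurd rfl hij
    · exact hPQ y b c h2 h1
    · exact hPQ x b c h1 h2
    · exact hPP x y (fun h => hij (by rw [h])) b c h1 h2

lemma oat_pow (s : ℕ) (hs : 5 ≤ s) : OAT (2 ^ s) := by
  letI : Fintype (GaloisField 2 s) := Fintype.ofFinite _
  have hc : Fintype.card (GaloisField 2 s) = 2 ^ s := by
    rw [← Nat.card_eq_fintype_card, GaloisField.card 2 s (by omega)]
  rw [← hc]
  refine OAT.of_field _ ?_
  rw [hc]
  exact Nat.pow_le_pow_right (n := 2) (by norm_num) hs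

lemma oat_base (s : ℕ) (hs : 5 ≤ s) (hs' : s ≤ 9) : OAT (992 * 2 ^ s) := by
  letI : Fintype (GaloisField 2 s) := Fintype.ofFinite _
  letI : Fintype (GaloisField 2 5) := Fintype.ofFinite _
  have hc : Fintype.card (GaloisField 2 s) = 2 ^ s := by
    rw [← Nat.card_eq_fintype_card, GaloisField.card 2 s (by omega)]
  have hc5 : Fintype.card (GaloisField 2 5) = 32 := by
    rw [← Nat.card_eq_fintype_card, GaloisField.card 2 5 (by omega)]
    norm_num
  rw [← hc]
  refine OAT.three (GaloisField 2 5) _ hc5 ?_ ?_ <;> rw [hc] <;> interval_cases s <;> norm_num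

lemma oat_main (t : ℕ) (ht : 10 ≤ t) : OAT (31 * 2 ^ t) := by
  by_cases h : t ≤ 14
  · have := oat_base (t - 5) (by omega) (by omega)
    have e : 992 * 2 ^ (t - 5) = 31 * 2 ^ t := by
      obtain ⟨s, rfl⟩ : ∃ s, t = s + 5 := ⟨t - 5, by omega⟩
      simp only [Nat.add_sub_cancel, pow_add]
      ring
    rwa [e] at this
  · have h1 := oat_base 5 (by omega) (by omega)
    have h2 := oat_pow (t - 10) (by omega)
    have e : 992 * 2 ^ 5 * 2 ^ (t - 10) = 31 * 2 ^ t := by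
      obtain ⟨s, rfl⟩ : ∃ s, t = s + 10 := ⟨t - 10, by omega⟩
      simp only [Nat.add_sub_cancel, pow_add]
      ring
    have := h1.mul h2
    rwa [e] at this

lemma OAT.hasMOLS {n : ℕ} (h : OAT n) : HasMOLS n 31 := by
  obtain ⟨f, hf⟩ := h
  have hb : ∀ i j, i ≠ j → Function.Bijective fun b => (f i b, f j b) := fun i j hij =>
    Finite.injective_iff_bijective.1 (hf i j hij)
  let E : Fin n × Fin n ≃ Fin n × Fin n := Equiv.ofBijective _ (hb none (some 0) (by simp))
  have hE : ∀ p, (f none (E.symm p), f (some 0) (E.symm p)) = p := fun p => E.apply_symm_apply p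
  have hE1 : ∀ p, f none (E.symm p) = p.1 := fun p => congrArg Prod.fst (hE p)
  have hE2 : ∀ p, f (some 0) (E.symm p) = p.2 := fun p => congrArg Prod.snd (hE p)
  refine ⟨fun s i j => f (some s.succ) (E.symm (i, j)), fun s => ⟨fun i => ?_, fun j => ?_⟩, ?_⟩
  · refine Finite.injective_iff_bijective.1 fun j j' h => ?_
    have := hf none (some s.succ) (by simp) (a₁ := E.symm (i, j)) (a₂ := E.symm (i, j'))
      (Prod.ext (by simp only [hE1]) h)
    simpa using this
  · refine Finite.injective_iff_bijective.1 fun i i' h => ?_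
    have := hf (some 0) (some s.succ) (fun h => (Fin.succ_ne_zero s) (Option.some.inj h).symm) (a₁ := E.symm (i, j))
      (a₂ := E.symm (i', j)) (Prod.ext (by simp only [hE2]) h)
    simpa using this
  · intro s t hst p p' h
    have := hf (some s.succ) (some t.succ) (by simpa using hst) (a₁ := E.symm (p.1, p.2))
      (a₂ := E.symm (p'.1, p'.2)) h
    simpa using this

lemma bdd_mols {n : ℕ} (hn : 2 ≤ n) : BddAbove {r | HasMOLS n r} := by
  refine ⟨Fintype.card (Fin n → Fin n → Fin n), ?_⟩
  rintro r ⟨L, hL, hO⟩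
  have hinj : Function.Injective L := by
    intro s t hst
    by_contra hne
    have ho := hO s t hne
    rw [hst] at ho
    let z : Fin n := ⟨0, by omega⟩
    let w : Fin n := ⟨1, by omega⟩
    obtain ⟨j, hj⟩ := ((hL t).1 w).2 (L t z z)
    have := ho (a₁ := (z, z)) (a₂ := (w, j)) (Prod.ext hj.symm hj.symm)
    simp [z, w] at this
  simpa using Fintype.card_le_of_injective L hinj

theorem molsNum_31_mul_two_pow : ∀ t : ℕ, 10 ≤ t → 31 ≤ molsNum (31 * 2 ^ t) := by
  intro t ht
  have hn : 2 ≤ 31 * 2 ^ t := by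
    have := Nat.one_le_two_pow (n := t)
    omega
  exact le_csSup (bdd_mols hn) (oat_main t ht).hasMOLS
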